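/- A continuous function f : ℝ → M into a complete metric space (M,d) is Bohr almost periodic if and only if for every pair of sequences (α'_n) and (β'_n) of real numbers there exist common subsequences (α_k = α'_{n_k}) and (β_k = β'_{n_k}) (extracted along the same index sequence n_k) such that: the functions t ↦ f(t + α_k + β_k) converge uniformly on ℝ to a function h, the functions t ↦ f(t + β_k) converge uniformly on ℝ to a function g, the functions t ↦ g(t + α_k) converge uniformly on ℝ, and their limit equals h. -/

import Mathlib

open Filter Topology Set

/-- A set `T ⊆ ℝ` is relatively dense if there is `l > 0` such that every open
interval `(a, a+l)` contains a point of `T`. -/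
def RelativelyDense (T : Set ℝ) : Prop :=
  ∃ l > 0, ∀ a : ℝ, ∃ τ ∈ Set.Ioo a (a + l), τ ∈ T

/-- `f : ℝ → M` is Bohr almost periodic: for every `ε > 0`,
the set of `ε`-almost periods of `f` is relatively dense in `ℝ`. -/
def IsBohrAP {M : Type*} [PseudoMetricSpace M] (f : ℝ → M) : Prop :=
  ∀ ε > 0, RelativelyDense {τ : ℝ | ∀ t : ℝ, dist (f (t + τ)) (f t) < ε}

theorem bohrAP_of_seq {M : Type*} [MetricSpace M] (f : ℝ → M)
    (H : ∀ β : ℕ → ℝ, ∃ φ : ℕ → ℕ, StrictMono φ ∧ ∃ g : ℝ → M,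
      TendstoUniformly (fun k t => f (t + β (φ k))) g atTop) : IsBohrAP f := by
  intro ε hε
  by_contra hn
  have key : ∀ l > 0, ∃ a : ℝ, ∀ τ ∈ Set.Ioo a (a + l),
      ¬ (∀ t : ℝ, dist (f (t + τ)) (f t) < ε) := by
    intro l hl
    by_contra h2
    push Not at h2
    exact hn ⟨l, hl, h2⟩
  obtain ⟨s, -, hs⟩ := exists_seq_of_forall_finset_exists (fun _ : ℝ => True)
    (fun x y => ¬ (∀ t : ℝ, dist (f (t + (y - x))) (f t) < ε)) (by
      intro S _
      obtain ⟨C, hC⟩ := (S.finite_toSet.isBounded).exists_norm_le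
      obtain ⟨a, ha⟩ := key (2 * |C| + 2) (by positivity)
      refine ⟨a + (|C| + 1), trivial, fun x hx => ha _ ?_⟩
      have h1 := hC x hx
      rw [Real.norm_eq_abs] at h1
      have h2 := abs_le.1 (h1.trans (le_abs_self C))
      constructor <;> linarith [h2.1, h2.2])
  obtain ⟨φ, hφ, g, hg⟩ := H s
  obtain ⟨N, hN⟩ := eventually_atTop.1 (Metric.tendstoUniformly_iff.1 hg (ε / 2) (half_pos hε))
  refine hs (φ N) (φ (N + 1)) (hφ (Nat.lt_succ_self N)) fun t => ?_
  have h1 := hN N le_rfl (t - s (φ N))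
  have h2 := hN (N + 1) (Nat.le_succ N) (t - s (φ N))
  rw [sub_add_cancel] at h1
  have e : t + (s (φ (N + 1)) - s (φ N)) = t - s (φ N) + s (φ (N + 1)) := by ring
  rw [e]
  have h3 := dist_triangle_left (f (t - s (φ N) + s (φ (N + 1)))) (f t) (g (t - s (φ N)))
  linarith

theorem IsBohrAP.uc {M : Type*} [MetricSpace M] {f : ℝ → M} (hf : Continuous f)
    (h : IsBohrAP f) : UniformContinuous f := by
  rw [Metric.uniformContinuous_iff]
  intro ε hε
  obtain ⟨l, hl, hT⟩ := h (ε / 3) (by positivity)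
  have hu := (isCompact_Icc (a := (-1 : ℝ)) (b := l + 1)).uniformContinuousOn_of_continuous
    hf.continuousOn
  obtain ⟨δ, hδ, hd⟩ := Metric.uniformContinuousOn_iff.1 hu (ε / 3) (by positivity)
  refine ⟨min δ 1, by positivity, fun {x y} hxy => ?_⟩
  obtain ⟨τ, ⟨h1, h2⟩, h3⟩ := hT (-x)
  have hxy1 := lt_of_lt_of_le hxy (min_le_left _ _)
  have hxy2 := lt_of_lt_of_le hxy (min_le_right _ _)
  rw [Real.dist_eq] at hxy2
  have h4 := abs_lt.1 hxy2
  have h5 := hd (x + τ) ⟨by linarith, by linarith⟩ (y + τ)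
    ⟨by linarith [h4.1, h4.2], by linarith [h4.1, h4.2]⟩ (by simpa using hxy1)
  have h6 := h3 x
  have h7 := h3 y
  rw [dist_comm] at h6
  have := dist_triangle4 (f x) (f (x + τ)) (f (y + τ)) (f y)
  linarith

theorem IsBohrAP.bdd {M : Type*} [MetricSpace M] {f : ℝ → M} (hf : Continuous f)
    (h : IsBohrAP f) : ∃ C, ∀ x y, dist (f x) (f y) ≤ C := by
  obtain ⟨l, hl, hT⟩ := h 1 one_pos
  obtain ⟨C, hC⟩ := Metric.isBounded_iff.1
    ((isCompact_Icc (a := (0 : ℝ)) (b := l)).image hf).isBounded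
  refine ⟨C + 2, fun x y => ?_⟩
  obtain ⟨τ, ⟨h1, h2⟩, h3⟩ := hT (-x)
  obtain ⟨σ, ⟨k1, k2⟩, k3⟩ := hT (-y)
  have h5 := hC (mem_image_of_mem f (show x + τ ∈ Icc 0 l from ⟨by linarith, by linarith⟩))
    (mem_image_of_mem f (show y + σ ∈ Icc 0 l from ⟨by linarith, by linarith⟩))
  have h6 := h3 x
  have h7 := k3 y
  rw [dist_comm] at h6
  have := dist_triangle4 (f x) (f (x + τ)) (f (y + σ)) (f y)
  linarith

open BoundedContinuousFunction in
theorem IsBohrAP.seq {M : Type*} [MetricSpace M] [CompleteSpace M] {f : ℝ → M}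
    (hf : Continuous f) (h : IsBohrAP f) (β : ℕ → ℝ) :
    ∃ φ : ℕ → ℕ, StrictMono φ ∧ ∃ g : ℝ → M,
      TendstoUniformly (fun k t => f (t + β (φ k))) g atTop := by
  obtain ⟨C, hC⟩ := h.bdd hf
  let F : ℝ → (ℝ →ᵇ M) := fun s => ⟨⟨fun t => f (t + s), by fun_prop⟩, C, fun x y => hC _ _⟩
  have hF : ∀ s t, F s t = f (t + s) := fun _ _ => rfl
  have hFc : Continuous F := by
    rw [Metric.continuous_iff]
    intro b ε hε
    obtain ⟨δ, hδ, hd⟩ := Metric.uniformContinuous_iff.1 (h.uc hf) (ε / 2) (by positivity)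
    refine ⟨δ, hδ, fun a hab => lt_of_le_of_lt ?_ (half_lt_self hε)⟩
    refine (dist_le (by positivity)).2 fun t => ?_
    rw [hF, hF]
    exact (hd (by simpa using hab)).le
  have htb : TotallyBounded (range F) := by
    rw [Metric.totallyBounded_iff]
    intro ε hε
    obtain ⟨l, hl, hT⟩ := h (ε / 2) (by positivity)
    obtain ⟨S, hS, hcov⟩ := Metric.totallyBounded_iff.1
      ((isCompact_Icc (a := (0 : ℝ)) (b := l)).image hFc).totallyBounded (ε / 2) (by positivity)
    refine ⟨S, hS, ?_⟩
    rintro _ ⟨s, rfl⟩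
    obtain ⟨τ, ⟨h1, h2⟩, h3⟩ := hT (-s)
    have := hcov (mem_image_of_mem F (show s + τ ∈ Icc 0 l from ⟨by linarith, by linarith⟩))
    simp only [mem_iUnion, Metric.mem_ball, exists_prop] at this ⊢
    obtain ⟨y, hy, hd⟩ := this
    refine ⟨y, hy, ?_⟩
    have h4 : dist (F s) (F (s + τ)) ≤ ε / 2 := by
      refine (dist_le (by positivity)).2 fun t => ?_
      rw [hF, hF, dist_comm, ← add_assoc]
      exact (h3 _).le
    have := dist_triangle (F s) (F (s + τ)) y
    linarith
  have hcomp : IsCompact (closure (range F)) :=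
    htb.closure.isCompact_of_isClosed isClosed_closure
  obtain ⟨g, -, φ, hφ, hg⟩ := hcomp.tendsto_subseq
    (x := fun n => F (β n)) (fun n => subset_closure (mem_range_self _))
  exact ⟨φ, hφ, g, tendsto_iff_tendstoUniformly.1 hg⟩

/-- Bochner's double-sequence criterion (uniform version): a continuous `f` is Bohr
almost periodic iff for all sequences `α'`, `β'` there are common subsequences
(along the same index sequence `φ`) such that `T_{α+β} f = T_α T_β f` uniformly on `ℝ`. -/
theorem bohrAP_iff_uniform_double_seq {M : Type*} [MetricSpace M] [CompleteSpace M]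
    (f : ℝ → M) (hf : Continuous f) :
    IsBohrAP f ↔
      ∀ α' β' : ℕ → ℝ, ∃ φ : ℕ → ℕ, StrictMono φ ∧
        ∃ h g : ℝ → M,
          TendstoUniformly (fun k t => f (t + (α' (φ k) + β' (φ k)))) h atTop ∧
          TendstoUniformly (fun k t => f (t + β' (φ k))) g atTop ∧
          TendstoUniformly (fun k t => g (t + α' (φ k))) h atTop := by
  constructor
  · intro h α' β'
    obtain ⟨φ, hφ, g, hg⟩ := h.seq hf β'
    obtain ⟨ψ, hψ, k, hk⟩ := h.seq hf (fun n => α' (φ n) + β' (φ n))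
    have hg' : TendstoUniformly (fun k t => f (t + β' (φ (ψ k)))) g atTop :=
      fun u hu => hψ.tendsto_atTop.eventually (hg u hu)
    refine ⟨φ ∘ ψ, hφ.comp hψ, k, g, hk, hg', ?_⟩
    rw [Metric.tendstoUniformly_iff] at hk hg' ⊢
    intro ε hε
    filter_upwards [hk (ε / 2) (half_pos hε), hg' (ε / 2) (half_pos hε)] with n h1 h2 t
    have h3 := h1 t
    have h4 := h2 (t + α' (φ (ψ n)))
    rw [add_assoc] at h4
    have := dist_triangle_right (k t) (g (t + α' (φ (ψ n))))
      (f (t + (α' (φ (ψ n)) + β' (φ (ψ n)))))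
    simp only [Function.comp]
    linarith
  · intro H
    refine bohrAP_of_seq f fun β => ?_
    obtain ⟨φ, hφ, _, g, _, hg, _⟩ := H (fun _ => 0) β
    exact ⟨φ, hφ, g, hg⟩
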